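/- Let f : ℝ → ℝ³ be a C^∞ embedding of period L parametrized by arc length with curvature κ(s) = |f''(s)| > 0 for all s, let P lie outside the curvature tube of f, let r > 0, and set f̃ = I_{P,r}∘f; assume f̃'(s) × f̃''(s) ≠ 0 for all s. Let n(s) = (f(s) − c(s))/ρ(s) be the unit normal at f(s) to the unique sphere Σ(s) containing the osculating circle of f at s and passing through P. Then the total torsion of f̃ equals the negative of the total angle variation of n along f: ∫₀^L τ_{f̃}(s) |f̃'(s)| ds = −∫₀^L f'(s)·(n(s) × n'(s)) ds. -/

import Mathlib

noncomputable section
open Real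

/-- Euclidean 3-space. -/
abbrev E3 : Type := EuclideanSpace ℝ (Fin 3)

/-- The dot product of two vectors in `E3`. -/
def dot3 (u v : E3) : ℝ := u 0 * v 0 + u 1 * v 1 + u 2 * v 2

/-- The cross product of two vectors in `E3`. -/
def cross3 (u v : E3) : E3 :=
  (WithLp.equiv 2 (Fin 3 → ℝ)).symm
    ![u 1 * v 2 - u 2 * v 1, u 2 * v 0 - u 0 * v 2, u 0 * v 1 - u 1 * v 0]

/-- The determinant `det(u, v, w)` of three vectors in `E3`. -/
def det3 (u v w : E3) : ℝ := dot3 u (cross3 v w)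

/-- The writhe of a closed curve `g` of period `L`, given by the Gauss integral. -/
def writhe (g : ℝ → E3) (L : ℝ) : ℝ :=
  (1 / (4 * π)) * ∫ s in (0:ℝ)..L, ∫ t in (0:ℝ)..L,
    det3 (deriv g s) (deriv g t) (g s - g t) / ‖g s - g t‖ ^ 3

/-- The inversion in the sphere of center `P` and radius `r`. -/
def inv3 (P : E3) (r : ℝ) (x : E3) : E3 := P + (r ^ 2 / ‖x - P‖ ^ 2) • (x - P)

/-- The differential of the inversion `inv3 P r` at `x`, applied to `v`. -/
def dInv (P : E3) (r : ℝ) (x v : E3) : E3 :=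
  (r ^ 2 / ‖x - P‖ ^ 2) • (v - ((2 * dot3 (x - P) v) / ‖x - P‖ ^ 2) • (x - P))

/-- The total twist of a closed curve `g` of period `L` with unit normal framing `w`. -/
def twist (g w : ℝ → E3) (L : ℝ) : ℝ :=
  (1 / (2 * π)) * ∫ s in (0:ℝ)..L,
    dot3 (deriv w s) (cross3 ((‖deriv g s‖)⁻¹ • deriv g s) (w s))

/-- The principal normal `e₂ = f''/κ` of an arc-length parametrized curve. -/
def e2 (f : ℝ → E3) (s : ℝ) : E3 := (‖deriv (deriv f) s‖)⁻¹ • deriv (deriv f) s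

/-- The binormal `e₃ = e₁ × e₂` of an arc-length parametrized curve. -/
def e3 (f : ℝ → E3) (s : ℝ) : E3 := cross3 (deriv f s) (e2 f s)

/-- The torsion `τ = e₂'·e₃` of an arc-length parametrized curve. -/
def torsionArc (f : ℝ → E3) (s : ℝ) : ℝ := dot3 (deriv (e2 f) s) (e3 f s)

/-- The total torsion `Tω = (1/2π) ∫ τ` of an arc-length parametrized closed curve. -/
def totalTorsionArc (f : ℝ → E3) (L : ℝ) : ℝ :=
  (1 / (2 * π)) * ∫ s in (0:ℝ)..L, torsionArc f s

/-- The torsion `τ_g = det(g', g'', g''')/|g' × g''|²` of a regular curve. -/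
def torsionGen (g : ℝ → E3) (s : ℝ) : ℝ :=
  det3 (deriv g s) (deriv (deriv g) s) (deriv (deriv (deriv g)) s) /
    ‖cross3 (deriv g s) (deriv (deriv g) s)‖ ^ 2

/-- The total torsion `Tω = (1/2π) ∫ τ_g |g'|` of a regular closed curve. -/
def totalTorsionGen (g : ℝ → E3) (L : ℝ) : ℝ :=
  (1 / (2 * π)) * ∫ s in (0:ℝ)..L, torsionGen g s * ‖deriv g s‖

/-- The osculating circle at `s` of an arc-length parametrized curve with `κ(s) > 0`:
the circle of center `f(s) + (1/κ(s)) e₂(s)` and radius `1/κ(s)` in the plane through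
`f(s)` spanned by `e₁(s)` and `e₂(s)`. -/
def osculatingCircleArc (f : ℝ → E3) (s : ℝ) : Set E3 :=
  {y | (∃ a b : ℝ, y = f s + a • deriv f s + b • e2 f s) ∧
    ‖y - (f s + (‖deriv (deriv f) s‖)⁻¹ • e2 f s)‖ = (‖deriv (deriv f) s‖)⁻¹}

/-- The curvature tube of `f`: the union of all osculating circles. -/
def curvatureTube (f : ℝ → E3) : Set E3 := ⋃ s : ℝ, osculatingCircleArc f s

lemma dot3_eq_inner (u v : E3) : dot3 u v = inner ℝ u v := by
  simp [dot3, PiLp.inner_apply, Fin.sum_univ_three, mul_comm]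

lemma dot3_self (u : E3) : dot3 u u = ‖u‖ ^ 2 := by
  rw [dot3_eq_inner, real_inner_self_eq_norm_sq]

lemma dot3_comm (u v : E3) : dot3 u v = dot3 v u := by
  simp only [dot3]; ring

lemma dot3_add_right (u v w : E3) : dot3 u (v + w) = dot3 u v + dot3 u w := by
  simp only [dot3, PiLp.add_apply]; ring

lemma dot3_sub_right (u v w : E3) : dot3 u (v - w) = dot3 u v - dot3 u w := by
  simp only [dot3, PiLp.sub_apply]; ring

lemma dot3_smul_right (a : ℝ) (u v : E3) : dot3 u (a • v) = a * dot3 u v := by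
  simp only [dot3, PiLp.smul_apply, smul_eq_mul]; ring

lemma dot3_sub_left (u v w : E3) : dot3 (u - v) w = dot3 u w - dot3 v w := by
  simp only [dot3, PiLp.sub_apply]; ring

lemma dot3_smul_left (a : ℝ) (u v : E3) : dot3 (a • u) v = a * dot3 u v := by
  simp only [dot3, PiLp.smul_apply, smul_eq_mul]; ring

@[simp] lemma cross3_apply_zero (u v : E3) : cross3 u v 0 = u 1 * v 2 - u 2 * v 1 := by
  simp [cross3]

@[simp] lemma cross3_apply_one (u v : E3) : cross3 u v 1 = u 2 * v 0 - u 0 * v 2 := by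
  simp [cross3]

@[simp] lemma cross3_apply_two (u v : E3) : cross3 u v 2 = u 0 * v 1 - u 1 * v 0 := by
  simp [cross3]

lemma dot3_cross3_self_left (u v : E3) : dot3 u (cross3 u v) = 0 := by
  simp only [dot3, cross3_apply_zero, cross3_apply_one, cross3_apply_two]; ring

lemma dot3_cross3_self_right (u v : E3) : dot3 v (cross3 u v) = 0 := by
  simp only [dot3, cross3_apply_zero, cross3_apply_one, cross3_apply_two]; ring

lemma HasDerivAt.dot3 {u v : ℝ → E3} {u' v' : E3} {s : ℝ}
    (hu : HasDerivAt u u' s) (hv : HasDerivAt v v' s) :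
    HasDerivAt (fun t => dot3 (u t) (v t)) (dot3 (u s) v' + dot3 u' (v s)) s := by
  simp only [dot3_eq_inner]
  exact hu.inner ℝ hv

/-- Differentiating a constant dot product. -/
lemma dot3_deriv_add_of_const {u v : ℝ → E3} {u' v' : E3} {s C : ℝ}
    (hu : HasDerivAt u u' s) (hv : HasDerivAt v v' s)
    (h : ∀ t, dot3 (u t) (v t) = C) : dot3 (u s) v' + dot3 u' (v s) = 0 := by
  have h1 := hu.dot3 hv
  rw [funext h] at h1
  exact h1.unique (hasDerivAt_const s C)

/-- A vector orthogonal to `a` and `b` is a multiple of `a × b`. -/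
lemma exists_eq_smul_cross3 {a b w : E3} (hab : cross3 a b ≠ 0)
    (ha : dot3 w a = 0) (hb : dot3 w b = 0) : ∃ k : ℝ, w = k • cross3 a b := by
  have hX : dot3 (cross3 a b) (cross3 a b) ≠ 0 := by
    rw [dot3_self]; exact pow_ne_zero 2 (norm_ne_zero_iff.2 hab)
  refine ⟨dot3 w (cross3 a b) / dot3 (cross3 a b) (cross3 a b), ?_⟩
  have key : dot3 (cross3 a b) (cross3 a b) • w = dot3 w (cross3 a b) • cross3 a b := by
    simp only [dot3] at ha hb
    ext i
    fin_cases i <;>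
      simp only [dot3, PiLp.smul_apply, smul_eq_mul, cross3_apply_zero, cross3_apply_one,
        cross3_apply_two, Fin.zero_eta, Fin.mk_one, Fin.reduceFinMk]
    · linear_combination
        (a 0 * (b 0 ^ 2 + b 1 ^ 2 + b 2 ^ 2) - b 0 * (a 0 * b 0 + a 1 * b 1 + a 2 * b 2)) * ha +
        (b 0 * (a 0 ^ 2 + a 1 ^ 2 + a 2 ^ 2) - a 0 * (a 0 * b 0 + a 1 * b 1 + a 2 * b 2)) * hb
    · linear_combination
        (a 1 * (b 0 ^ 2 + b 1 ^ 2 + b 2 ^ 2) - b 1 * (a 0 * b 0 + a 1 * b 1 + a 2 * b 2)) * ha +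
        (b 1 * (a 0 ^ 2 + a 1 ^ 2 + a 2 ^ 2) - a 1 * (a 0 * b 0 + a 1 * b 1 + a 2 * b 2)) * hb
    · linear_combination
        (a 2 * (b 0 ^ 2 + b 1 ^ 2 + b 2 ^ 2) - b 2 * (a 0 * b 0 + a 1 * b 1 + a 2 * b 2)) * ha +
        (b 2 * (a 0 ^ 2 + a 1 ^ 2 + a 2 ^ 2) - a 2 * (a 0 * b 0 + a 1 * b 1 + a 2 * b 2)) * hb
  rw [div_eq_inv_mul, mul_smul, ← key, smul_smul, inv_mul_cancel₀ hX, one_smul]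

/-- The torsion of a curve with derivatives `a, b, d`, in terms of a vector `w` normal to the
osculating plane and its derivative `w'`. -/
lemma det3_div_mul_norm_eq {a b d w w' : E3} (hab : cross3 a b ≠ 0) (hw : w ≠ 0)
    (hwa : dot3 w a = 0) (hwb : dot3 w b = 0) (hwa' : dot3 w' a = 0)
    (hwd : dot3 w d + dot3 w' b = 0) :
    det3 a b d / ‖cross3 a b‖ ^ 2 * ‖a‖ = det3 a w w' / (‖a‖ * ‖w‖ ^ 2) := by
  obtain ⟨k, rfl⟩ := exists_eq_smul_cross3 hab hwa hwb
  have hk : k ≠ 0 := fun h => hw (by simp [h])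
  have hX : ‖cross3 a b‖ ≠ 0 := norm_ne_zero_iff.2 hab
  have ha : ‖a‖ ≠ 0 := by
    rw [norm_ne_zero_iff]
    rintro rfl
    exact hab (by ext i; fin_cases i <;> simp)
  have h1 : det3 a b d = dot3 (cross3 a b) d := by
    simp only [det3, dot3, cross3_apply_zero, cross3_apply_one, cross3_apply_two]; ring
  have h2 : det3 a (k • cross3 a b) w' = k * (dot3 a b * dot3 w' a - ‖a‖ ^ 2 * dot3 w' b) := by
    rw [← dot3_self]
    simp only [det3, dot3, cross3_apply_zero, cross3_apply_one, cross3_apply_two,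
      PiLp.smul_apply, smul_eq_mul]
    ring
  rw [dot3_smul_left] at hwd
  rw [h1, h2, hwa', norm_smul, Real.norm_eq_abs, mul_pow, sq_abs, eq_div_iff (by positivity)]
  field_simp
  linear_combination ‖a‖ ^ 2 * hwd

/-- Reflecting in `u` the triple `T, m, m'` changes the sign of its determinant, when `m` is the
radius vector of spheres enveloping a curve with tangent `T` and passing through a fixed point at
position `-u`. -/
lemma det3_reflect {T u m w' : E3} (hT : dot3 T T = 1) (hmT : dot3 m T = 0)
    (hu : u ≠ 0) (hmu : 2 * dot3 m u = dot3 u u) (hw'T : dot3 w' T = 0) (hw'u : dot3 w' u = 0) :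
    det3 (T - (2 * dot3 u T / dot3 u u) • u) (m - u) w' = -det3 T m (w' + T) := by
  have huu : dot3 u u ≠ 0 := by
    rw [dot3_self]; exact pow_ne_zero 2 (norm_ne_zero_iff.2 hu)
  have hTu : cross3 T u ≠ 0 := by
    intro h
    have h1 : dot3 (cross3 T m) (cross3 T u) = dot3 T T * dot3 m u - dot3 T u * dot3 m T := by
      simp only [dot3, cross3_apply_zero, cross3_apply_one, cross3_apply_two]; ring
    have h2 : dot3 (cross3 T m) (0 : E3) = 0 := by simp [dot3]
    rw [h, h2, hT, hmT] at h1
    exact huu (by linear_combination -hmu - 2 * h1)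
  obtain ⟨k, rfl⟩ := exists_eq_smul_cross3 hTu hw'T hw'u
  set a := 2 * dot3 u T / dot3 u u with ha
  have ha' : a * dot3 u u = 2 * dot3 u T := div_mul_cancel₀ _ huu
  have h1 : det3 (T - a • u) (m - u) (k • cross3 T u) =
      k * ((dot3 T T * dot3 m u - dot3 T u * dot3 m T)
        - (dot3 T T * dot3 u u - dot3 u T ^ 2)
        - a * (dot3 u T * dot3 m u - dot3 u u * dot3 m T)) := by
    simp only [det3, dot3, cross3_apply_zero, cross3_apply_one, cross3_apply_two,
      PiLp.smul_apply, PiLp.sub_apply, smul_eq_mul]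
    ring
  have h2 : det3 T m (k • cross3 T u + T) =
      k * (dot3 T T * dot3 m u - dot3 T u * dot3 m T) := by
    simp only [det3, dot3, cross3_apply_zero, cross3_apply_one, cross3_apply_two,
      PiLp.smul_apply, PiLp.add_apply, smul_eq_mul]
    ring
  rw [h1, h2, hT, hmT]
  linear_combination k * (1 - a * dot3 u T / 2) * hmu - k * dot3 u T / 2 * ha'

lemma hasDerivAt_inv3_comp {f : ℝ → E3} {f' P : E3} {r s : ℝ} (hf : HasDerivAt f f' s)
    (hP : f s ≠ P) :
    HasDerivAt (fun t => inv3 P r (f t)) (dInv P r (f s) f') s := by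
  have hu : HasDerivAt (fun t => f t - P) f' s := hf.sub_const P
  have hne : dot3 (f s - P) (f s - P) ≠ 0 := by
    rw [dot3_self]; exact pow_ne_zero 2 (norm_ne_zero_iff.2 (sub_ne_zero.2 hP))
  have h := (((hasDerivAt_const s (r ^ 2)).div (hu.dot3 hu) hne).smul hu).const_add P
  simp only [inv3, dInv, ← dot3_self]
  refine h.congr_deriv ?_
  simp only [Pi.div_apply]
  rw [dot3_comm f' (f s - P), smul_sub _ f', smul_smul, sub_eq_add_neg _ (_ • _), ← neg_smul]
  congr 2
  field_simp
  ring

lemma contDiff_inv3_comp {f : ℝ → E3} {P : E3} {r : ℝ} {n : WithTop ℕ∞} (hf : ContDiff ℝ n f)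
    (hP : ∀ s, f s ≠ P) : ContDiff ℝ n (fun t => inv3 P r (f t)) := by
  have hu : ContDiff ℝ n (fun t => f t - P) := hf.sub contDiff_const
  exact contDiff_const.add ((contDiff_const.div (hu.norm_sq ℝ) fun s =>
    pow_ne_zero 2 (norm_ne_zero_iff.2 (sub_ne_zero.2 (hP s)))).smul hu)

lemma norm_dInv {P : E3} {r : ℝ} {x v : E3} (hx : x ≠ P) :
    ‖dInv P r x v‖ = r ^ 2 / ‖x - P‖ ^ 2 * ‖v‖ := by
  have hne : dot3 (x - P) (x - P) ≠ 0 := by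
    rw [dot3_self]; exact pow_ne_zero 2 (norm_ne_zero_iff.2 (sub_ne_zero.2 hx))
  rw [dInv, norm_smul, Real.norm_of_nonneg (by positivity)]
  congr 1
  rw [← sq_eq_sq₀ (norm_nonneg _) (norm_nonneg _), ← dot3_self, ← dot3_self, ← dot3_self]
  generalize x - P = u at hne ⊢
  rw [dot3_sub_left, dot3_sub_right, dot3_sub_right, dot3_smul_left, dot3_smul_left,
    dot3_smul_right, dot3_smul_right, dot3_comm v u]
  field_simp
  ring

/-- The angle variation of a unit normal field, computed from the unnormalized field. -/
lemma dot3_cross3_deriv_normalize {m : ℝ → E3} {m' T : E3} {s : ℝ} (hm : HasDerivAt m m' s)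
    (h0 : m s ≠ 0) :
    dot3 T (cross3 (‖m s‖⁻¹ • m s) (deriv (fun t => ‖m t‖⁻¹ • m t) s)) =
      det3 T (m s) m' / ‖m s‖ ^ 2 := by
  have hd := (((hm.differentiableAt.norm ℝ h0).inv (norm_ne_zero_iff.2 h0)).hasDerivAt).smul hm
  have hd' : deriv (fun t => ‖m t‖⁻¹ • m t) s = _ := hd.deriv
  rw [hd']
  have h0' := norm_ne_zero_iff.2 h0
  simp only [det3, dot3, cross3_apply_zero, cross3_apply_one, cross3_apply_two,
    PiLp.smul_apply, PiLp.add_apply, smul_eq_mul, Pi.inv_apply]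
  field_simp
  ring


/-- Proposition 4. The total torsion of the inverted knot
`f̃ = I_{P,r} ∘ f` equals the negative of the total angle variation of the unit
normal `n(s) = (f(s) − c(s))/ρ(s)` to the sphere `Σ(s)` along `f`:
`∫ τ_{f̃} |f̃'| ds = −∫ f'·(n × n') ds`. -/
theorem totalTorsion_of_inverted_knot
    (f : ℝ → E3) (L : ℝ) (hL : 0 < L)
    (hf : ContDiff ℝ (⊤ : ℕ∞) f) (hper : Function.Periodic f L)
    (harc : ∀ s, ‖deriv f s‖ = 1) (hinj : Set.InjOn f (Set.Ico 0 L))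
    (hκ : ∀ s, ‖deriv (deriv f) s‖ > 0)
    (P : E3) (hP : P ∉ curvatureTube f) (r : ℝ) (hr : 0 < r)
    (hreg : ∀ s, cross3 (deriv (fun t => inv3 P r (f t)) s)
        (deriv (deriv (fun t => inv3 P r (f t))) s) ≠ 0)
    (c : ℝ → E3) (ρ μ : ℝ → ℝ)
    (hc : ContDiff ℝ (⊤ : ℕ∞) c) (hμ : ContDiff ℝ (⊤ : ℕ∞) μ)
    (hcdef : ∀ s, c s = f s + (‖deriv (deriv f) s‖)⁻¹ • e2 f s + μ s • e3 f s)
    (hρdef : ∀ s, ρ s = ‖f s - c s‖)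
    (hPc : ∀ s, ‖P - c s‖ = ρ s) :
    (∫ s in (0:ℝ)..L,
        torsionGen (fun t => inv3 P r (f t)) s * ‖deriv (fun t => inv3 P r (f t)) s‖)
      = -∫ s in (0:ℝ)..L,
          dot3 (deriv f s)
            (cross3 ((ρ s)⁻¹ • (f s - c s))
              (deriv (fun t => (ρ t)⁻¹ • (f t - c t)) s)) := by
  have hf1 : ContDiff ℝ (⊤ : ℕ∞) (deriv f) := contDiff_infty_iff_deriv.1 hf |>.2
  have hdf : ∀ s, HasDerivAt f (deriv f s) s := fun s =>
    (hf.differentiable (by simp) s).hasDerivAt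
  have hddf : ∀ s, HasDerivAt (deriv f) (deriv (deriv f) s) s := fun s =>
    (hf1.differentiable (by simp) s).hasDerivAt
  have hdc : ∀ s, HasDerivAt c (deriv c s) s := fun s =>
    (hc.differentiable (by simp) s).hasDerivAt
  have hTT : ∀ s, dot3 (deriv f s) (deriv f s) = 1 := fun s => by
    rw [dot3_self, harc, one_pow]
  have hTN : ∀ s, dot3 (deriv f s) (deriv (deriv f) s) = 0 := fun s => by
    have h := dot3_deriv_add_of_const (hddf s) (hddf s) hTT
    rw [dot3_comm (deriv (deriv f) s)] at h
    linarith
  have hfP : ∀ s, f s ≠ P := by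
    intro s h
    refine hP (Set.mem_iUnion.2 ⟨s, ⟨0, 0, by simp [h]⟩, ?_⟩)
    have hk := hκ s
    rw [← h, sub_add_cancel_left, norm_neg, e2, norm_smul, norm_smul, norm_inv, norm_norm,
      inv_mul_cancel₀ hk.ne', mul_one]
  have hmdef : ∀ s, f s - c s =
      -((‖deriv (deriv f) s‖)⁻¹ • e2 f s + μ s • e3 f s) := fun s => by
    rw [hcdef]; abel
  have hmT : ∀ s, dot3 (f s - c s) (deriv f s) = 0 := fun s => by
    rw [hmdef, dot3_comm, ← neg_one_smul ℝ, dot3_smul_right, dot3_add_right, dot3_smul_right,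
      dot3_smul_right, e3, dot3_cross3_self_left, e2, dot3_smul_right, hTN]
    ring
  have hmN : ∀ s, dot3 (f s - c s) (deriv (deriv f) s) = -1 := fun s => by
    have hk := (hκ s).ne'
    have h : dot3 (deriv (deriv f) s) (e3 f s) = 0 := by
      have h' := dot3_cross3_self_right (deriv f s) (e2 f s)
      rw [e2, dot3_smul_left] at h'
      exact (mul_eq_zero.1 h').resolve_left (inv_ne_zero hk)
    rw [hmdef, dot3_comm, ← neg_one_smul ℝ, dot3_smul_right, dot3_add_right, dot3_smul_right,
      dot3_smul_right, h, e2, dot3_smul_right, dot3_self]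
    field_simp
    ring
  have hdm : ∀ s, HasDerivAt (fun t => f t - c t) (deriv f s - deriv c s) s := fun s =>
    (hdf s).sub (hdc s)
  have hdu : ∀ s, HasDerivAt (fun t => f t - P) (deriv f s) s := fun s => (hdf s).sub_const P
  have hdw : ∀ s, HasDerivAt (fun t => P - c t) (-deriv c s) s := fun s => (hdc s).const_sub P
  have hm0 : ∀ s, f s - c s ≠ 0 := fun s h => by
    have := hmN s
    rw [h] at this
    simp [dot3] at this
  have hw0 : ∀ s, P - c s ≠ 0 := fun s => by
    rw [← norm_ne_zero_iff, hPc, hρdef, norm_ne_zero_iff]; exact hm0 s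
  have hwm : ∀ s, P - c s = (f s - c s) - (f s - P) := fun s => by abel
  have hmu : ∀ s, 2 * dot3 (f s - c s) (f s - P) = dot3 (f s - P) (f s - P) := fun s => by
    have h : dot3 (P - c s) (P - c s) = dot3 (f s - c s) (f s - c s) := by
      rw [dot3_self, dot3_self, hPc, hρdef]
    rw [hwm, dot3_sub_left, dot3_sub_right, dot3_sub_right (f s - P),
      dot3_comm (f s - P) (f s - c s)] at h
    linarith
  have hw'T : ∀ s, dot3 (-deriv c s) (deriv f s) = 0 := fun s => by
    have h := dot3_deriv_add_of_const (hdm s) (hddf s) hmT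
    rw [hmN, dot3_sub_left, hTT] at h
    rw [← neg_one_smul ℝ, dot3_smul_left]
    linarith
  have hw'u : ∀ s, dot3 (-deriv c s) (f s - P) = 0 := fun s => by
    have h := dot3_deriv_add_of_const
      (u := fun t => (2 : ℝ) • (f t - c t) - (f t - P)) (C := 0)
      (((hdm s).const_smul (2 : ℝ)).sub (hdu s)) (hdu s) (fun t => by
        rw [dot3_sub_left, dot3_smul_left, hmu, sub_self])
    simp only [dot3_sub_left (_ • _), dot3_smul_left] at h
    rw [hmT, dot3_sub_left (deriv f s) (deriv c s), dot3_comm (deriv f s) (f s - P)] at h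
    rw [← neg_one_smul ℝ, dot3_smul_left]
    linarith
  set g : ℝ → E3 := fun t => inv3 P r (f t) with hg
  have hgs : ContDiff ℝ (⊤ : ℕ∞) g := contDiff_inv3_comp hf hfP
  have hg1 : ContDiff ℝ (⊤ : ℕ∞) (deriv g) := contDiff_infty_iff_deriv.1 hgs |>.2
  have hg2 : ContDiff ℝ (⊤ : ℕ∞) (deriv (deriv g)) := contDiff_infty_iff_deriv.1 hg1 |>.2
  have hdg : ∀ s, deriv g s = dInv P r (f s) (deriv f s) := fun s =>
    (hasDerivAt_inv3_comp (hdf s) (hfP s)).deriv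
  have hwg : ∀ s, dot3 (P - c s) (deriv g s) = 0 := fun s => by
    have hne : dot3 (f s - P) (f s - P) ≠ 0 := by
      rw [dot3_self]; exact pow_ne_zero 2 (norm_ne_zero_iff.2 (sub_ne_zero.2 (hfP s)))
    have h := hmu s
    have hT := hmT s
    rw [hdg, dInv, ← dot3_self, hwm]
    generalize f s - c s = m at h hT ⊢
    generalize f s - P = u at hne h ⊢
    rw [dot3_smul_right, dot3_sub_right, dot3_smul_right, dot3_sub_left, dot3_sub_left, hT]
    field_simp
    linear_combination -r ^ 2 * dot3 u (deriv f s) * h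
  have hw'g : ∀ s, dot3 (-deriv c s) (deriv g s) = 0 := fun s => by
    rw [hdg, dInv, dot3_smul_right, dot3_sub_right, dot3_smul_right, hw'T, hw'u]
    ring
  have hwg2 : ∀ s, dot3 (P - c s) (deriv (deriv g) s) = 0 := fun s => by
    have h := dot3_deriv_add_of_const (hdw s) (hg1.differentiable (by simp) s).hasDerivAt hwg
    rwa [hw'g, add_zero] at h
  have hwg3 : ∀ s, dot3 (P - c s) (deriv (deriv (deriv g)) s) +
      dot3 (-deriv c s) (deriv (deriv g) s) = 0 := fun s =>
    dot3_deriv_add_of_const (hdw s) (hg2.differentiable (by simp) s).hasDerivAt hwg2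
  rw [← intervalIntegral.integral_neg]
  refine intervalIntegral.integral_congr fun s _ => ?_
  have hq : r ^ 2 / ‖f s - P‖ ^ 2 ≠ 0 := by
    have := norm_ne_zero_iff.2 (sub_ne_zero.2 (hfP s))
    positivity
  have hrefl := det3_reflect (hTT s) (hmT s) (sub_ne_zero.2 (hfP s)) (hmu s) (hw'T s) (hw'u s)
  rw [← hwm, neg_add_eq_sub] at hrefl
  have hdet : det3 (deriv g s) (P - c s) (-deriv c s) =
      r ^ 2 / ‖f s - P‖ ^ 2 * -det3 (deriv f s) (f s - c s) (deriv f s - deriv c s) := by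
    rw [← hrefl, hdg, dInv, det3, dot3_smul_left, dot3_self]
    rfl
  simp only [hρdef]
  rw [dot3_cross3_deriv_normalize (hdm s) (hm0 s), torsionGen,
    det3_div_mul_norm_eq (hreg s) (hw0 s) (hwg s) (hwg2 s) (hw'g s) (hwg3 s), hdet, hdg,
    norm_dInv (hfP s), harc, mul_one, mul_div_mul_left _ _ hq, hPc, hρdef, neg_div]
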